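/- Let n ≥ 5 and let F be a family of subsets of {1,...,n} with no four distinct members A, B, C, D satisfying A ∪ B ⊆ C ∩ D. If |F| = C(n, ⌊n/2⌋) + C(n, ⌊n/2⌋+1), then there exists k such that F consists exactly of all subsets of size k together with all subsets of size k+1. -/

import Mathlib

open Finset Numbering
open scoped Nat

variable {α : Type*}

/-- No four distinct members `A, B, C, D` of the family satisfy `A ∪ B ⊆ C ∩ D`. -/
def ButterflyFree [DecidableEq α] (F : Finset (Finset α)) : Prop :=
  ∀ A ∈ F, ∀ B ∈ F, ∀ C ∈ F, ∀ D ∈ F,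
    A ≠ B → A ≠ C → A ≠ D → B ≠ C → B ≠ D → C ≠ D → ¬ (A ∪ B ⊆ C ∩ D)

lemma ButterflyFree.eq_of_ssubset_middle [DecidableEq α] {F : Finset (Finset α)}
    {A M B X : Finset α} (hF : ButterflyFree F) (hA : A ∈ F)
    (hM : M ∈ F) (hB : B ∈ F) (hX : X ∈ F) (hAM : A ⊂ M) (hMB : M ⊂ B) (hXM : X ⊂ M) : X = A := by
  by_contra hne
  exact hF A hA X hX M hM B hB (Ne.symm hne) hAM.ne (hAM.trans hMB).ne hXM.ne (hXM.trans hMB).ne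
    hMB.ne (union_subset (subset_inter hAM.1 (hAM.trans hMB).1)
      (subset_inter hXM.1 (hXM.trans hMB).1))

lemma ButterflyFree.eq_of_middle_ssubset [DecidableEq α] {F : Finset (Finset α)}
    {A M B X : Finset α} (hF : ButterflyFree F) (hA : A ∈ F)
    (hM : M ∈ F) (hB : B ∈ F) (hX : X ∈ F) (hAM : A ⊂ M) (hMB : M ⊂ B) (hMX : M ⊂ X) : X = B := by
  by_contra hne
  exact hF A hA M hM B hB X hX hAM.ne (hAM.trans hMB).ne (hAM.trans hMX).ne hMB.ne hMX.ne
    (Ne.symm hne) (union_subset (subset_inter (hAM.trans hMB).1 (hAM.trans hMX).1)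
      (subset_inter hMB.1 hMX.1))

lemma IsPrefix.ssubset_or_ssubset [Fintype α] {f : Numbering α} {A B : Finset α}
    (hA : IsPrefix f A) (hB : IsPrefix f B) (hne : A ≠ B) : A ⊂ B ∨ B ⊂ A := by
  rcases le_total #A #B with h | h
  · exact .inl ((hA.subset_of_card_le_card hB h).ssubset_of_ne hne)
  · exact .inr ((hB.subset_of_card_le_card hA h).ssubset_of_ne hne.symm)

section Swap
variable [DecidableEq α]

/-- The image of a set under the transposition of `x` and `y`. -/
def swapSet (x y : α) (A : Finset α) : Finset α := A.map (Equiv.swap x y).toEmbedding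

@[simp] lemma card_swapSet (x y : α) (A : Finset α) : #(swapSet x y A) = #A := card_map _

lemma mem_swapSet {x y z : α} {A : Finset α} : z ∈ swapSet x y A ↔ Equiv.swap x y z ∈ A := by
  simp [swapSet, mem_map_equiv]

lemma swapSet_eq_self {x y : α} {M : Finset α} (h : x ∈ M ↔ y ∈ M) : swapSet x y M = M := by
  ext z
  rw [mem_swapSet, Equiv.swap_apply_def]
  grind

variable [Fintype α]

lemma isPrefix_swap_trans {f : Numbering α} {x y : α} {A : Finset α} (h : IsPrefix f A) :
    IsPrefix ((Equiv.swap x y).trans f) (swapSet x y A) := by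
  intro z
  rw [mem_swapSet, h, card_swapSet]
  rfl

lemma card_prefixed_swapSet_inter {x y : α} {A M : Finset α} (h : x ∈ M ↔ y ∈ M) :
    #(prefixed A ∩ prefixed M) ≤ #(prefixed (swapSet x y A) ∩ prefixed M) := by
  refine card_le_card_of_injOn (fun f ↦ (Equiv.swap x y).trans f) ?_ ?_
  · intro f hf
    simp only [coe_inter, Set.mem_inter_iff, mem_coe, mem_prefixed] at hf ⊢
    refine ⟨isPrefix_swap_trans hf.1, ?_⟩
    simpa only [swapSet_eq_self h] using isPrefix_swap_trans (x := x) (y := y) hf.2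
  · intro f _ g _ hfg
    ext z
    have := congrArg (fun e ↦ (e (Equiv.swap x y z) : ℕ)) hfg
    simpa using this

lemma disjoint_prefixed_of_card_eq {s t : Finset α} (h : #s = #t) (hne : s ≠ t) :
    Disjoint (prefixed s) (prefixed t) :=
  disjoint_prefixed_prefixed (fun hs ↦ hne (eq_of_subset_of_card_le hs h.ge))
    (fun hs ↦ hne (eq_of_subset_of_card_le hs h.le).symm)

lemma prefixed_nonempty (s : Finset α) : (prefixed s).Nonempty := by
  rw [← card_pos, card_prefixed]
  positivity

lemma two_mul_card_prefixed_inter_le {x y : α} {A M : Finset α} (hx : x ∈ A) (hy : y ∉ A)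
    (h : x ∈ M ↔ y ∈ M) : 2 * #(prefixed A ∩ prefixed M) ≤ #(prefixed M) := by
  have hne : A ≠ swapSet x y A := by
    intro e
    rw [e, mem_swapSet, Equiv.swap_apply_left] at hx
    exact hy hx
  have hd : Disjoint (prefixed A ∩ prefixed M) (prefixed (swapSet x y A) ∩ prefixed M) :=
    (disjoint_prefixed_of_card_eq (by simp) hne).mono inter_subset_left inter_subset_left
  have hle := card_le_card (union_subset (inter_subset_right (s₁ := prefixed A) (s₂ := prefixed M))
    (inter_subset_right (s₁ := prefixed (swapSet x y A)) (s₂ := prefixed M)))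
  rw [card_union_of_disjoint hd] at hle
  have := card_prefixed_swapSet_inter (A := A) h
  omega

lemma three_mul_card_prefixed_inter_le {x y z : α} {A M : Finset α} (hx : x ∈ A) (hy : y ∉ A)
    (h : x ∈ M ↔ y ∈ M) (hz : x ∈ M ↔ z ∈ M) (hzx : z ≠ x) (hzy : z ≠ y) :
    3 * #(prefixed A ∩ prefixed M) ≤ #(prefixed M) := by
  obtain ⟨C, hC, hCA, hCxy, hle⟩ : ∃ C, #C = #A ∧ C ≠ A ∧ C ≠ swapSet x y A ∧
      #(prefixed A ∩ prefixed M) ≤ #(prefixed C ∩ prefixed M) := by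
    by_cases hzA : z ∈ A
    · refine ⟨swapSet z y A, by simp, ?_, ?_, card_prefixed_swapSet_inter (by tauto)⟩
      · intro e
        rw [← e, mem_swapSet, Equiv.swap_apply_left] at hzA
        exact hy hzA
      · intro e
        have := Finset.ext_iff.1 e x
        rw [mem_swapSet, mem_swapSet, Equiv.swap_apply_left,
          Equiv.swap_apply_of_ne_of_ne hzx.symm (by grind)] at this
        tauto
    · refine ⟨swapSet x z A, by simp, ?_, ?_, card_prefixed_swapSet_inter hz⟩
      · intro e
        rw [← e, mem_swapSet, Equiv.swap_apply_left] at hx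
        exact hzA hx
      · intro e
        have := Finset.ext_iff.1 e z
        rw [mem_swapSet, mem_swapSet, Equiv.swap_apply_right,
          Equiv.swap_apply_of_ne_of_ne hzx hzy] at this
        tauto
  have hne : A ≠ swapSet x y A := by
    intro e
    rw [e, mem_swapSet, Equiv.swap_apply_left] at hx
    exact hy hx
  have hd : Disjoint (prefixed A ∩ prefixed M) (prefixed (swapSet x y A) ∩ prefixed M) :=
    (disjoint_prefixed_of_card_eq (by simp) hne).mono inter_subset_left inter_subset_left
  have hd' : Disjoint (prefixed A ∩ prefixed M ∪ prefixed (swapSet x y A) ∩ prefixed M)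
      (prefixed C ∩ prefixed M) :=
    disjoint_union_left.2
      ⟨(disjoint_prefixed_of_card_eq hC.symm hCA.symm).mono inter_subset_left inter_subset_left,
        (disjoint_prefixed_of_card_eq (by simp [hC]) hCxy.symm).mono
          inter_subset_left inter_subset_left⟩
  have hsub : prefixed A ∩ prefixed M ∪ prefixed (swapSet x y A) ∩ prefixed M ∪
      prefixed C ∩ prefixed M ⊆ prefixed M := by grind
  have hcard := card_le_card hsub
  rw [card_union_of_disjoint hd', card_union_of_disjoint hd] at hcard
  have := card_prefixed_swapSet_inter (A := A) h
  omega

lemma card_prefixed_between_lt {A M B : Finset α} (hcard : 5 ≤ Fintype.card α) (hA : A ≠ ∅)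
    (hB : B ≠ univ) (hAM : A ⊂ M) (hMB : M ⊂ B) :
    #(prefixed M ∩ (prefixed A ∩ prefixed B)) < #(prefixed M \ (prefixed A ∪ prefixed B)) := by
  obtain ⟨x, hx⟩ := nonempty_iff_ne_empty.2 hA
  obtain ⟨y, hyM, hyA⟩ := exists_of_ssubset hAM
  obtain ⟨u, huB, huM⟩ := exists_of_ssubset hMB
  obtain ⟨v, hvB⟩ : ∃ v, v ∉ B := by
    by_contra! h
    exact hB (eq_univ_iff_forall.2 h)
  have hxM := hAM.1 hx
  have hvM : v ∉ M := fun h ↦ hvB (hMB.1 h)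
  have hlo := two_mul_card_prefixed_inter_le (M := M) hx hyA (by tauto)
  have hhi := two_mul_card_prefixed_inter_le (M := M) huB hvB (by tauto)
  have hpos := card_pos.2 (prefixed_nonempty M)
  have hlt : #(prefixed A ∩ prefixed M) + #(prefixed B ∩ prefixed M) < #(prefixed M) := by
    by_cases hM : 3 ≤ #M
    · obtain ⟨z, hz⟩ : ((M.erase x).erase y).Nonempty := by
        rw [← card_pos]
        grind
      have := three_mul_card_prefixed_inter_le (z := z) (M := M) hx hyA (by tauto) (by grind)
        (by grind) (by grind)
      omega
    · obtain ⟨z, hz⟩ : ((Mᶜ.erase u).erase v).Nonempty := by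
        rw [← card_pos]
        have := card_compl M
        have := mem_compl.2 huM
        have := mem_compl.2 hvM
        grind
      have hzM : z ∉ M := by simp_all
      have := three_mul_card_prefixed_inter_le (z := z) (M := M) huB hvB (by tauto) (by grind)
        (by grind) (by grind)
      omega
  have h₁ := card_union_add_card_inter (prefixed A ∩ prefixed M) (prefixed B ∩ prefixed M)
  have h₂ := card_sdiff_add_card_inter (prefixed M) (prefixed A ∪ prefixed B)
  rw [show prefixed M ∩ (prefixed A ∪ prefixed B) =
    prefixed A ∩ prefixed M ∪ prefixed B ∩ prefixed M by grind] at h₂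
  rw [show prefixed A ∩ prefixed M ∩ (prefixed B ∩ prefixed M) =
    prefixed M ∩ (prefixed A ∩ prefixed B) by grind] at h₁
  omega

end Swap

section Chain
variable [DecidableEq α] [Fintype α] {F : Finset (Finset α)} {f : Numbering α}

/-- The members of `F` lying on the full chain of prefixes of `f`. -/
def chainMembers (F : Finset (Finset α)) (f : Numbering α) : Finset (Finset α) :=
  {A ∈ F | IsPrefix f A}

lemma mem_chainMembers {A : Finset α} : A ∈ chainMembers F f ↔ A ∈ F ∧ IsPrefix f A := by
  simp [chainMembers]

lemma sum_card_chainMembers (F : Finset (Finset α)) :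
    ∑ f, #(chainMembers F f) = ∑ A ∈ F, (#A)! * (Fintype.card α - #A)! := by
  simp_rw [← card_prefixed, chainMembers, prefixed, card_filter]
  exact sum_comm

lemma exists_chain_of_three_le (h : 3 ≤ #(chainMembers F f)) :
    ∃ A ∈ chainMembers F f, ∃ M ∈ chainMembers F f, ∃ B ∈ chainMembers F f, A ⊂ M ∧ M ⊂ B := by
  obtain ⟨A, hA, B, hB, C, hC, hAB, hAC, hBC⟩ := two_lt_card.1 h
  have hA' := (mem_chainMembers.1 hA).2
  have hB' := (mem_chainMembers.1 hB).2
  have hC' := (mem_chainMembers.1 hC).2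
  rcases IsPrefix.ssubset_or_ssubset hA' hB' hAB with h₁ | h₁ <;>
  rcases IsPrefix.ssubset_or_ssubset hA' hC' hAC with h₂ | h₂ <;>
  rcases IsPrefix.ssubset_or_ssubset hB' hC' hBC with h₃ | h₃
  · exact ⟨A, hA, B, hB, C, hC, h₁, h₃⟩
  · exact ⟨A, hA, C, hC, B, hB, h₂, h₃⟩
  · exact absurd (h₁.trans h₃) h₂.asymm
  · exact ⟨C, hC, A, hA, B, hB, h₂, h₁⟩
  · exact ⟨B, hB, A, hA, C, hC, h₁, h₂⟩
  · exact absurd (h₃.trans h₁) h₂.asymm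
  · exact ⟨B, hB, C, hC, A, hA, h₃, h₂⟩
  · exact ⟨C, hC, B, hB, A, hA, h₃, h₁⟩

lemma ButterflyFree.chainMembers_subset {A M B : Finset α} (hF : ButterflyFree F) (hA : A ∈ F)
    (hM : M ∈ F) (hB : B ∈ F) (hAM : A ⊂ M) (hMB : M ⊂ B) (hf : IsPrefix f M) :
    chainMembers F f ⊆ {A, M, B} := by
  intro X hX
  rw [mem_chainMembers] at hX
  by_cases hXM : X = M
  · simp [hXM]
  rcases IsPrefix.ssubset_or_ssubset hX.2 hf hXM with h | h
  · simp [hF.eq_of_ssubset_middle hA hM hB hX.1 hAM hMB h]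
  · simp [hF.eq_of_middle_ssubset hA hM hB hX.1 hAM hMB h]

/-- A factorial form of the LYM inequality for butterfly-free families, with its equality case. -/
theorem ButterflyFree.sum_factorial_le (hF : ButterflyFree F) (hcard : 5 ≤ Fintype.card α)
    (hempty : ∅ ∉ F) (huniv : univ ∉ F) :
    ∑ A ∈ F, (#A)! * (Fintype.card α - #A)! ≤ 2 * (Fintype.card α)! ∧
    (∑ A ∈ F, (#A)! * (Fintype.card α - #A)! = 2 * (Fintype.card α)! →
      (∀ f, #(chainMembers F f) = 2) ∧
        ∀ A ∈ F, ∀ M ∈ F, ∀ B ∈ F, A ⊂ M → ¬ M ⊂ B) := by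
  classical
  set mid : Finset (Finset α) := {M ∈ F | ∃ A ∈ F, ∃ B ∈ F, A ⊂ M ∧ M ⊂ B}
  have hex : ∀ M ∈ mid, ∃ A B, A ∈ F ∧ B ∈ F ∧ A ⊂ M ∧ M ⊂ B := by
    intro M hM
    obtain ⟨-, A, hA, B, hB, h⟩ := mem_filter.1 hM
    exact ⟨A, B, hA, hB, h⟩
  choose! lo hi hloF hhiF hlo hhi using hex
  have hmidF : ∀ M ∈ mid, M ∈ F := fun M hM ↦ (mem_filter.1 hM).1
  let T : Finset α → Finset (Numbering α) := fun M ↦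
    prefixed M ∩ (prefixed (lo M) ∩ prefixed (hi M))
  let S : Finset α → Finset (Numbering α) := fun M ↦
    prefixed M \ (prefixed (lo M) ∪ prefixed (hi M))
  have hTS : ∀ M ∈ mid, #(T M) < #(S M) := fun M hM ↦
    card_prefixed_between_lt hcard (fun h ↦ hempty (h ▸ hloF M hM))
      (fun h ↦ huniv (h ▸ hhiF M hM)) (hlo M hM) (hhi M hM)
  have hsub : ∀ M ∈ mid, ∀ f, IsPrefix f M → chainMembers F f ⊆ {lo M, M, hi M} :=
    fun M hM f hf ↦ hF.chainMembers_subset (hloF M hM) (hmidF M hM) (hhiF M hM)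
      (hlo M hM) (hhi M hM) hf
  have hS : ∀ M ∈ mid, ∀ f ∈ S M, chainMembers F f = {M} := by
    intro M hM f hf
    simp only [S, mem_sdiff, mem_union, mem_prefixed, not_or] at hf
    refine eq_singleton_iff_unique_mem.2 ⟨mem_chainMembers.2 ⟨hmidF M hM, hf.1⟩, fun X hX ↦ ?_⟩
    have := hsub M hM f hf.1 hX
    have := (mem_chainMembers.1 hX).2
    grind
  have hdisj : (mid : Set (Finset α)).PairwiseDisjoint S := by
    intro M hM M' hM' hne
    refine Finset.disjoint_left.2 fun f hf hf' ↦ hne ?_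
    exact singleton_injective ((hS M hM f hf).symm.trans (hS M' hM' f hf'))
  have hpt : ∀ f, #(chainMembers F f) + (if f ∈ mid.biUnion S then 1 else 0) ≤
      2 + (if f ∈ mid.biUnion T then 1 else 0) := by
    intro f
    by_cases h3 : 3 ≤ #(chainMembers F f)
    · obtain ⟨A, hA, M, hM, B, hB, hAM, hMB⟩ := exists_chain_of_three_le h3
      rw [mem_chainMembers] at hA hM hB
      have hMm : M ∈ mid := mem_filter.2 ⟨hM.1, A, hA.1, B, hB.1, hAM, hMB⟩
      have hAe := hF.eq_of_ssubset_middle (hloF M hMm) hM.1 (hhiF M hMm) hA.1 (hlo M hMm)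
        (hhi M hMm) hAM
      have hBe := hF.eq_of_middle_ssubset (hloF M hMm) hM.1 (hhiF M hMm) hB.1 (hlo M hMm)
        (hhi M hMm) hMB
      have hT : f ∈ mid.biUnion T := by
        refine mem_biUnion.2 ⟨M, hMm, ?_⟩
        simp only [T, mem_inter, mem_prefixed]
        exact ⟨hM.2, hAe ▸ hA.2, hBe ▸ hB.2⟩
      have hSn : f ∉ mid.biUnion S := by
        intro h
        obtain ⟨M', hM', hf⟩ := mem_biUnion.1 h
        rw [hS M' hM' f hf] at h3
        simp at h3
      have := (card_le_card (hsub M hMm f hM.2)).trans card_le_three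
      simp [hT, hSn, this]
    · split_ifs with h₁ h₂ h₂
      · omega
      · obtain ⟨M', hM', hf⟩ := mem_biUnion.1 h₁
        rw [hS M' hM' f hf]
        simp
      · omega
      · omega
  have hsum := sum_le_sum fun f (_ : f ∈ univ) ↦ hpt f
  have hSsum : #(mid.biUnion S) = ∑ M ∈ mid, #(S M) := card_biUnion hdisj
  have hTsum : #(mid.biUnion T) ≤ ∑ M ∈ mid, #(T M) := card_biUnion_le
  have hTSsum : ∑ M ∈ mid, #(T M) ≤ ∑ M ∈ mid, #(S M) := sum_le_sum fun M hM ↦ (hTS M hM).le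
  simp only [sum_add_distrib, sum_card_chainMembers, sum_const, card_univ, smul_eq_mul,
    Fintype.card_numbering, sum_boole, filter_univ_mem, Nat.cast_id] at hsum
  refine ⟨by omega, fun heq ↦ ?_⟩
  have hmid0 : mid = ∅ := by
    by_contra hne
    have := sum_lt_sum_of_nonempty (nonempty_iff_ne_empty.2 hne) hTS
    omega
  constructor
  · have hle : ∀ f ∈ univ, #(chainMembers F f) ≤ 2 := by
      intro f _
      simpa [hmid0] using hpt f
    have := (sum_eq_sum_iff_of_le hle).1 (by
      rw [sum_card_chainMembers, heq]
      simp [Fintype.card_numbering, mul_comm])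
    exact fun f ↦ this f (mem_univ f)
  · intro A hA M hM B hB hAM hMB
    have : M ∈ mid := mem_filter.2 ⟨hM, A, hA, B, hB, hAM, hMB⟩
    simp [hmid0] at this

/-- A LYM-type inequality for families in which no set lies strictly below two others. -/
theorem two_mul_sum_factorial_le (huniv : univ ∉ F)
    (hF : ∀ A ∈ F, ∀ C ∈ F, ∀ D ∈ F, A ⊂ C → A ⊂ D → C = D) :
    2 * ∑ A ∈ F, (#A)! * (Fintype.card α - #A)! ≤ 3 * (Fintype.card α)! := by
  classical
  set low : Finset (Finset α) := {A ∈ F | ∃ B ∈ F, A ⊂ B}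
  have hex : ∀ A ∈ low, ∃ B, B ∈ F ∧ A ⊂ B := fun A hA ↦ (mem_filter.1 hA).2
  choose! hi hhiF hhi using hex
  have hlowF : ∀ A ∈ low, A ∈ F := fun A hA ↦ (mem_filter.1 hA).1
  have hchain : ∀ f, ∀ A ∈ low, IsPrefix f A → chainMembers F f ⊆ {A, hi A} := by
    intro f A hA hf X hX
    rw [mem_chainMembers] at hX
    by_cases hXA : X = A
    · simp [hXA]
    rcases IsPrefix.ssubset_or_ssubset hX.2 hf hXA with h | h
    · exact absurd (hF X hX.1 A (hlowF A hA) (hi A) (hhiF A hA) h (h.trans (hhi A hA)))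
        (hhi A hA).ne
    · simp [hF A (hlowF A hA) X hX.1 (hi A) (hhiF A hA) h (hhi A hA)]
  let T : Finset α → Finset (Numbering α) := fun A ↦ prefixed (hi A) ∩ prefixed A
  have hT : ∀ A ∈ low, 2 * #(T A) ≤ #(prefixed A) := by
    intro A hA
    obtain ⟨u, huB, huA⟩ := exists_of_ssubset (hhi A hA)
    obtain ⟨v, hvB⟩ : ∃ v, v ∉ hi A := by
      by_contra! h
      exact huniv (eq_univ_iff_forall.2 h ▸ hhiF A hA)
    have hvA : v ∉ A := fun h ↦ hvB ((hhi A hA).1 h)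
    exact two_mul_card_prefixed_inter_le huB hvB (by tauto)
  have hdisj : (low : Set (Finset α)).PairwiseDisjoint prefixed := by
    intro A hA A' hA' hne
    refine Finset.disjoint_left.2 fun f hf hf' ↦ ?_
    rw [mem_prefixed] at hf hf'
    have h₁ := hchain f A hA hf (mem_chainMembers.2 ⟨hlowF A' hA', hf'⟩)
    have h₂ := hchain f A' hA' hf' (mem_chainMembers.2 ⟨hlowF A hA, hf⟩)
    simp only [mem_insert, mem_singleton, hne, hne.symm, false_or] at h₁ h₂
    have h₃ := hhi A hA
    have h₄ := hhi A' hA'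
    rw [← h₁] at h₃
    rw [← h₂] at h₄
    exact h₃.asymm h₄
  have hpt : ∀ f, #(chainMembers F f) ≤ 1 + (if f ∈ low.biUnion T then 1 else 0) := by
    intro f
    by_cases h2 : 1 < #(chainMembers F f)
    · obtain ⟨A, hA, B, hB, hAB⟩ : ∃ A ∈ chainMembers F f, ∃ B ∈ chainMembers F f, A ⊂ B := by
        obtain ⟨A, hA, B, hB, hne⟩ := one_lt_card.1 h2
        rcases IsPrefix.ssubset_or_ssubset (mem_chainMembers.1 hA).2 (mem_chainMembers.1 hB).2 hne
          with h | h
        · exact ⟨A, hA, B, hB, h⟩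
        · exact ⟨B, hB, A, hA, h⟩
      rw [mem_chainMembers] at hA hB
      have hAl : A ∈ low := mem_filter.2 ⟨hA.1, B, hB.1, hAB⟩
      have hBe := hF A hA.1 B hB.1 (hi A) (hhiF A hAl) hAB (hhi A hAl)
      have hfT : f ∈ low.biUnion T := by
        refine mem_biUnion.2 ⟨A, hAl, ?_⟩
        simp only [T, mem_inter, mem_prefixed]
        exact ⟨hBe ▸ hB.2, hA.2⟩
      have := (card_le_card (hchain f A hAl hA.2)).trans card_le_two
      simp [hfT, this]
    · omega
  have hsum := sum_le_sum fun f (_ : f ∈ univ) ↦ hpt f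
  have hTsum : #(low.biUnion T) ≤ ∑ A ∈ low, #(T A) := card_biUnion_le
  have hpre : ∑ A ∈ low, #(prefixed A) ≤ (Fintype.card α)! := by
    rw [← card_biUnion hdisj]
    exact (card_le_univ _).trans_eq Fintype.card_numbering
  have hTle := sum_le_sum hT
  rw [← mul_sum] at hTle
  simp only [sum_add_distrib, sum_card_chainMembers, sum_const, card_univ, smul_eq_mul,
    Fintype.card_numbering, sum_boole, filter_univ_mem, Nat.cast_id] at hsum
  omega

end Chain

section Binomial

lemma choose_lt_choose_of_lt {n k l : ℕ} (hkl : k < l) (hl : 2 * l ≤ n) :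
    n.choose k < n.choose l := by
  induction l, hkl using Nat.le_induction with
  | base =>
    have h := n.choose_succ_right_eq k
    have hpos := Nat.choose_pos (n := n) (k := k) (by omega)
    obtain ⟨d, hd⟩ : ∃ d, n - k = k + 2 + d := ⟨n - k - (k + 2), by omega⟩
    rw [hd] at h
    nlinarith
  | succ l hl' ih =>
    refine (ih (by omega)).trans_le ?_
    have h := n.choose_succ_right_eq l
    obtain ⟨d, hd⟩ : ∃ d, n - l = l + 1 + d := ⟨n - l - (l + 1), by omega⟩
    rw [hd] at h
    nlinarith

lemma choose_le_choose_half_succ {n k : ℕ} (hk : k ≤ n) (hn : 2 ≤ n) (hne : k ≠ n / 2) :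
    n.choose k ≤ n.choose (n / 2 + 1) ∧
      (n.choose k = n.choose (n / 2 + 1) → k = n / 2 + 1 ∨ k + 1 = n / 2 ∧ 2 * (n / 2) = n) := by
  have hmin : n.choose k = n.choose (min k (n - k)) := by
    rcases le_total k (n - k) with h | h
    · rw [min_eq_left h]
    · rw [min_eq_right h, Nat.choose_symm hk]
  rw [hmin, ← Nat.choose_symm (show n / 2 + 1 ≤ n by omega)]
  rcases lt_or_ge (min k (n - k)) (n - (n / 2 + 1)) with h | h
  · have := choose_lt_choose_of_lt (n := n) h (by omega)
    exact ⟨this.le, fun he ↦ absurd he this.ne⟩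
  · have he : min k (n - k) = n - (n / 2 + 1) := by omega
    rw [he]
    exact ⟨le_rfl, fun _ ↦ by omega⟩

lemma choose_half_add_four_lt {n : ℕ} (hn : 5 ≤ n) :
    n.choose (n / 2) + 4 < 2 * n.choose (n / 2 + 1) := by
  rcases hn.eq_or_lt with rfl | hn
  · decide
  have h := n.choose_succ_right_eq (n / 2)
  have h₁ : 6 ≤ n.choose 1 := by rwa [Nat.choose_one_right]
  have h₂ := choose_lt_choose_of_lt (n := n) (k := 1) (l := 2) (by omega) (by omega)
  have h₃ : 15 ≤ n.choose 2 := (by decide : 15 ≤ Nat.choose 6 2).trans (Nat.choose_le_choose 2 hn)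
  have h₄ := Nat.choose_le_middle 2 n
  generalize n.choose (n / 2) = a at *
  generalize n.choose (n / 2 + 1) = b at *
  obtain ⟨d, hd⟩ : ∃ d, n / 2 = 3 + d := ⟨n / 2 - 3, by omega⟩
  have h₅ : a * (3 + d) ≤ b * (4 + d) := by
    calc a * (3 + d) ≤ a * (n - n / 2) := Nat.mul_le_mul_left a (by omega)
      _ = b * (4 + d) := by rw [← h, hd]; ring
  nlinarith

lemma factorial_mul_factorial_le_of_choose_le {n k l : ℕ} (hk : k ≤ n) (hl : l ≤ n)
    (h : n.choose k ≤ n.choose l) : l ! * (n - l)! ≤ k ! * (n - k)! := by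
  have h₁ := Nat.choose_mul_factorial_mul_factorial hk
  have h₂ := Nat.choose_mul_factorial_mul_factorial hl
  rw [mul_assoc] at h₁ h₂
  by_contra! hlt
  have := Nat.mul_lt_mul_of_le_of_lt h hlt (Nat.choose_pos hl)
  omega

lemma choose_eq_of_factorial_mul_factorial_eq {n k l : ℕ} (hk : k ≤ n) (hl : l ≤ n)
    (h : l ! * (n - l)! = k ! * (n - k)!) : n.choose k = n.choose l := by
  rw [Nat.choose_eq_factorial_div_factorial hk, Nat.choose_eq_factorial_div_factorial hl, h]

end Binomial

section Extremal
variable [Fintype α] {F : Finset (Finset α)}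

lemma sum_factorial_le_imp_levels (hn : 2 ≤ Fintype.card α)
    (hcard : #F = (Fintype.card α).choose (Fintype.card α / 2) +
      (Fintype.card α).choose (Fintype.card α / 2 + 1))
    (hsum : ∑ A ∈ F, (#A)! * (Fintype.card α - #A)! ≤ 2 * (Fintype.card α)!) :
    ∑ A ∈ F, (#A)! * (Fintype.card α - #A)! = 2 * (Fintype.card α)! ∧
    (∀ A ∈ F, #A = Fintype.card α / 2 ∨ #A = Fintype.card α / 2 + 1 ∨
      #A + 1 = Fintype.card α / 2 ∧ 2 * (Fintype.card α / 2) = Fintype.card α) ∧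
    (2 * (Fintype.card α / 2) = Fintype.card α → ∀ A, #A = Fintype.card α / 2 → A ∈ F) := by
  set n := Fintype.card α with hn'
  set h := n / 2 with hh
  have ha := Nat.choose_mul_factorial_mul_factorial (show h ≤ n by omega)
  have hb := Nat.choose_mul_factorial_mul_factorial (show h + 1 ≤ n by omega)
  rw [mul_assoc] at ha hb
  have hwab : h ! * (n - h)! ≤ (h + 1)! * (n - (h + 1))! :=
    factorial_mul_factorial_le_of_choose_le (by omega) (by omega) (Nat.choose_le_middle _ _)
  have hpart := sum_filter_add_sum_filter_not F (fun A ↦ #A = h)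
    (fun A ↦ (#A)! * (n - #A)!)
  have hcardpart := card_filter_add_card_filter_not (s := F) (fun A ↦ #A = h)
  have hsub : {A ∈ F | #A = h} ⊆ powersetCard h univ := fun A hA ↦ by
    simpa using (mem_filter.1 hA).2
  have hx := card_le_card hsub
  rw [card_powersetCard, card_univ] at hx
  have hlow : ∑ A ∈ F with #A = h, (#A)! * (n - #A)! = #{A ∈ F | #A = h} * (h ! * (n - h)!) :=
    sum_const_nat fun A hA ↦ by rw [(mem_filter.1 hA).2]
  have hle : ∀ A ∈ {A ∈ F | ¬ #A = h},
      (h + 1)! * (n - (h + 1))! ≤ (#A)! * (n - #A)! := fun A hA ↦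
    factorial_mul_factorial_le_of_choose_le (card_le_univ A) (by omega)
      (choose_le_choose_half_succ (card_le_univ A) hn (mem_filter.1 hA).2).1
  have hhigh := sum_le_sum hle
  rw [sum_const, smul_eq_mul] at hhigh
  rw [← hn'] at hx
  generalize hwa : h ! * (n - h)! = wa at *
  generalize hwb : (h + 1)! * (n - (h + 1))! = wb at *
  obtain ⟨d, hd⟩ := Nat.exists_eq_add_of_le hx
  obtain ⟨e, he⟩ := Nat.exists_eq_add_of_le hwab
  have hy : #{A ∈ F | ¬ #A = h} = n.choose (h + 1) + d := by omega
  have hmul : #{A ∈ F | #A = h} * wa + #{A ∈ F | ¬ #A = h} * wb = 2 * n ! + d * e := by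
    rw [hy, two_mul]
    nth_rw 1 [← ha]
    rw [← hb, hd, he]
    ring
  have hde : d * e = 0 := by omega
  have hhigheq : ∑ A ∈ F with ¬ #A = h, wb = ∑ A ∈ F with ¬ #A = h, (#A)! * (n - #A)! := by
    rw [sum_const, smul_eq_mul]
    omega
  refine ⟨by omega, fun A hA ↦ ?_, fun heven A hA ↦ ?_⟩
  · by_cases hAh : #A = h
    · exact .inl hAh
    have hmem : A ∈ {A ∈ F | ¬ #A = h} := mem_filter.2 ⟨hA, hAh⟩
    have := (sum_eq_sum_iff_of_le hle).1 hhigheq A hmem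
    rw [← hwb] at this
    exact .inr ((choose_le_choose_half_succ (card_le_univ A) hn hAh).2
      (choose_eq_of_factorial_mul_factorial_eq (card_le_univ A) (by omega) this))
  · have hd0 : d = 0 := by
      rcases mul_eq_zero.1 hde with h0 | h0
      · exact h0
      · exfalso
        have h₁ := choose_eq_of_factorial_mul_factorial_eq (n := n) (k := h + 1) (l := h)
          (by omega) (by omega) (by rw [hwa, hwb, he, h0, add_zero])
        have h₂ := choose_lt_choose_of_lt (n := n) (k := n - (h + 1)) (l := h) (by omega)
          (by omega)
        rw [Nat.choose_symm (by omega)] at h₂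
        omega
    have heq := eq_of_subset_of_card_le hsub (by
      rw [card_powersetCard, card_univ, ← hn']
      omega)
    have : A ∈ {A ∈ F | #A = h} := by
      rw [heq]
      simpa using hA
    exact (mem_filter.1 this).1

variable [DecidableEq α]

lemma exists_isPrefix_erase {T : Finset α} {u : α} (hu : u ∈ T) :
    ∃ f : Numbering α, IsPrefix f T ∧ IsPrefix f (T.erase u) := by
  obtain ⟨f, hf⟩ := prefixed_nonempty T
  rw [mem_prefixed] at hf
  have hpos := card_pos.2 ⟨u, hu⟩
  have hlt : #T - 1 < Fintype.card α := by
    have := card_le_univ T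
    omega
  set v := f.symm ⟨#T - 1, hlt⟩ with hv
  have hfv : (f v : ℕ) = #T - 1 := by simp [hv]
  have hvT : v ∈ T := (hf v).2 (by omega)
  refine ⟨(Equiv.swap u v).trans f, ?_, fun z ↦ ?_⟩
  · have := isPrefix_swap_trans (x := u) (y := v) hf
    rwa [swapSet_eq_self (by tauto)] at this
  · have hne : z ≠ u ↔ (f (Equiv.swap u v z) : ℕ) ≠ #T - 1 := by
      rw [← hfv, not_iff_not, Fin.val_inj, f.apply_eq_iff_eq, Equiv.swap_apply_eq_iff,
        Equiv.swap_apply_right]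
    have hT : z ∈ T ↔ (f (Equiv.swap u v z) : ℕ) < #T := by
      rw [← hf, ← mem_swapSet, swapSet_eq_self (by tauto)]
    rw [mem_erase, card_erase_of_mem hu, hne, hT, Equiv.trans_apply]
    omega

lemma ButterflyFree.image_compl (hF : ButterflyFree F) : ButterflyFree (F.image compl) := by
  intro A hA B hB C hC D hD hAB hAC hAD hBC hBD hCD hsub
  simp only [mem_image] at hA hB hC hD
  obtain ⟨A, hA, rfl⟩ := hA
  obtain ⟨B, hB, rfl⟩ := hB
  obtain ⟨C, hC, rfl⟩ := hC
  obtain ⟨D, hD, rfl⟩ := hD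
  simp only [ne_eq, compl_inj_iff] at hAB hAC hAD hBC hBD hCD
  refine hF C hC D hD A hA B hB hCD (Ne.symm hAC) (Ne.symm hBC) (Ne.symm hAD) (Ne.symm hBD) hAB ?_
  rw [← compl_inter, ← compl_union] at hsub
  exact compl_subset_compl.1 hsub

lemma ButterflyFree.empty_notMem (hF : ButterflyFree F) (hn : 5 ≤ Fintype.card α)
    (hcard : #F = (Fintype.card α).choose (Fintype.card α / 2) +
      (Fintype.card α).choose (Fintype.card α / 2 + 1)) : ∅ ∉ F := by
  intro hempty
  have hsum := two_mul_sum_factorial_le (F := (F.erase ∅).erase univ) (notMem_erase _ _) (by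
    intro A hA C hC D hD hAC hAD
    simp only [mem_erase] at hA hC hD
    by_contra hCD
    exact hF ∅ hempty A hA.2.2 C hC.2.2 D hD.2.2 hA.2.1.symm hC.2.1.symm hD.2.1.symm hAC.ne
      hAD.ne hCD (by rw [empty_union]; exact subset_inter hAC.1 hAD.1))
  have h₁ := pred_card_le_card_erase (s := F) (a := ∅)
  have h₂ := pred_card_le_card_erase (s := F.erase ∅) (a := univ)
  set n := Fintype.card α
  have ha := Nat.choose_mul_factorial_mul_factorial (show n / 2 ≤ n by omega)
  rw [mul_assoc] at ha
  have hle : ∀ A ∈ (F.erase ∅).erase univ, (n / 2)! * (n - n / 2)! ≤ (#A)! * (n - #A)! :=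
    fun A _ ↦ factorial_mul_factorial_le_of_choose_le (card_le_univ A) (by omega)
      (Nat.choose_le_middle _ _)
  have hlow := sum_le_sum hle
  rw [sum_const, smul_eq_mul] at hlow
  have hbin := choose_half_add_four_lt hn
  have hpos : 0 < (n / 2)! * (n - n / 2)! := by positivity
  generalize (n / 2)! * (n - n / 2)! = w at *
  have hlt : 3 * n.choose (n / 2) < 2 * #((F.erase ∅).erase univ) := by omega
  have := Nat.mul_lt_mul_of_pos_right hlt hpos
  nlinarith

lemma eq_of_card_eq_of_forall_mem {k : ℕ}
    (hcard : #F = (Fintype.card α).choose k + (Fintype.card α).choose (k + 1))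
    (h : ∀ A ∈ F, #A = k ∨ #A = k + 1) :
    F = powersetCard k univ ∪ powersetCard (k + 1) univ := by
  refine eq_of_subset_of_card_le (fun A hA ↦ by simpa using h A hA) ?_
  refine (card_union_le _ _).trans ?_
  rw [card_powersetCard, card_powersetCard, card_univ, hcard]

lemma eq_of_card_eq_of_forall_card {k : ℕ}
    (hcard : #F = (Fintype.card α).choose k + (Fintype.card α).choose (k + 1))
    (h : ∀ A : Finset α, #A = k ∨ #A = k + 1 → A ∈ F) :
    F = powersetCard k univ ∪ powersetCard (k + 1) univ := by
  refine (eq_of_subset_of_card_le (fun A hA ↦ h A (by simpa using hA)) ?_).symm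
  rw [card_union_of_disjoint (pairwise_disjoint_powersetCard _ (by simp)), card_powersetCard,
    card_powersetCard, card_univ, hcard]

/-- If every full chain meets `F` in two sets, no member of `F` lies strictly between two others,
`F` lives on the levels `k - 1`, `k`, `k + 1` and contains all of level `k`, then a single member
on level `k + 1` forces that whole level to lie in `F`. -/
lemma forall_mem_of_exists_mem {k : ℕ} (hk : ∀ A : Finset α, #A = k → A ∈ F)
    (hlevel : ∀ A ∈ F, #A = k ∨ #A = k + 1 ∨ #A + 1 = k)
    (hchain : ∀ f, #(chainMembers F f) = 2)
    (hmid : ∀ A ∈ F, ∀ M ∈ F, ∀ B ∈ F, A ⊂ M → ¬ M ⊂ B)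
    (hex : ∃ B ∈ F, #B = k + 1) (T : Finset α) (hT : #T = k + 1) : T ∈ F := by
  have step : ∀ M B, #M = k → B ∈ F → M ⊂ B → ∀ u ∉ M, insert u M ∈ F := by
    intro M B hM hB hMB u hu
    obtain ⟨f, hfT, hfM⟩ := exists_isPrefix_erase (mem_insert_self u M)
    rw [erase_insert hu] at hfM
    have hMf : M ∈ chainMembers F f := mem_chainMembers.2 ⟨hk M hM, hfM⟩
    obtain ⟨X, hX, hXM⟩ := exists_mem_ne (by rw [hchain f]; omega) M
    rw [mem_chainMembers] at hX
    rcases IsPrefix.ssubset_or_ssubset hX.2 hfM hXM with h | h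
    · exact absurd hMB (hmid X hX.1 M (hk M hM) B hB h)
    · have hlt := card_lt_card h
      have hXcard : #X = #(insert u M) := by
        rw [card_insert_of_notMem hu]
        have := hlevel X hX.1
        omega
      rw [← (hX.2.subset_of_card_le_card hfT hXcard.le).antisymm
        (hfT.subset_of_card_le_card hX.2 hXcard.ge)]
      exact hX.1
  have connected : ∀ m, ∀ M M' : Finset α, #(M' \ M) = m → #M = k → #M' = k →
      (∃ B ∈ F, M ⊂ B) → ∃ B ∈ F, M' ⊂ B := by
    intro m
    induction m with
    | zero =>
      intro M M' hm hM hM' hB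
      rw [card_eq_zero, sdiff_eq_empty_iff_subset] at hm
      rwa [eq_of_subset_of_card_le hm (by omega)]
    | succ m ih =>
      rintro M M' hm hM hM' ⟨B, hB, hMB⟩
      obtain ⟨u, hu⟩ : (M' \ M).Nonempty := card_pos.1 (by omega)
      obtain ⟨v, hv⟩ : (M \ M').Nonempty := by
        rw [← card_pos, card_sdiff_comm (hM.trans hM'.symm)]
        omega
      rw [mem_sdiff] at hu hv
      have huT := step M B hM hB hMB u hu.2
      have hvT : v ∈ insert u M := mem_insert_of_mem hv.1
      refine ih ((insert u M).erase v) M' ?_ ?_ hM' ⟨_, huT, erase_ssubset hvT⟩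
      · have : M' \ (insert u M).erase v = (M' \ M).erase u := by
          ext w
          simp only [mem_sdiff, mem_erase, mem_insert]
          by_cases hw : w = v
          · simp [hw, hv]
          · tauto
        rw [this, card_erase_of_mem (mem_sdiff.2 hu), hm, Nat.add_sub_cancel]
      · rw [card_erase_of_mem hvT, card_insert_of_notMem hu.2, hM, Nat.add_sub_cancel]
  obtain ⟨B, hB, hBk⟩ := hex
  obtain ⟨b, hb⟩ : B.Nonempty := card_pos.1 (by omega)
  obtain ⟨t, ht⟩ : T.Nonempty := card_pos.1 (by omega)
  have hTk : #(T.erase t) = k := by rw [card_erase_of_mem ht, hT, Nat.add_sub_cancel]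
  obtain ⟨C, hC, hTC⟩ := connected _ (B.erase b) (T.erase t) rfl
    (by rw [card_erase_of_mem hb, hBk, Nat.add_sub_cancel]) hTk ⟨B, hB, erase_ssubset hb⟩
  have := step _ C hTk hC hTC t (notMem_erase t T)
  rwa [insert_erase ht] at this

/-- A butterfly-free family of maximum size consists of two consecutive full levels. -/
theorem ButterflyFree.eq_union_powersetCard (hF : ButterflyFree F) (hn : 5 ≤ Fintype.card α)
    (hcard : #F = (Fintype.card α).choose (Fintype.card α / 2) +
      (Fintype.card α).choose (Fintype.card α / 2 + 1)) :
    ∃ k, F = powersetCard k univ ∪ powersetCard (k + 1) univ := by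
  have hempty : ∅ ∉ F := hF.empty_notMem hn hcard
  have huniv : univ ∉ F := fun h ↦ hF.image_compl.empty_notMem hn
    (by rw [card_image_of_injective _ compl_injective, hcard]) (mem_image.2 ⟨univ, h, by simp⟩)
  obtain ⟨hle, hext⟩ := hF.sum_factorial_le hn hempty huniv
  obtain ⟨heq, hlevel, hfull⟩ := sum_factorial_le_imp_levels (by omega) hcard hle
  obtain ⟨hchain, hmid⟩ := hext heq
  by_cases heven : 2 * (Fintype.card α / 2) = Fintype.card α
  · by_cases hex : ∃ B ∈ F, #B = Fintype.card α / 2 + 1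
    · refine ⟨_, eq_of_card_eq_of_forall_card hcard ?_⟩
      rintro A (hA | hA)
      · exact hfull heven A hA
      · exact forall_mem_of_exists_mem (hfull heven) (fun A hA ↦ by grind) hchain hmid hex A hA
    · refine ⟨Fintype.card α / 2 - 1, eq_of_card_eq_of_forall_mem ?_ fun A hA ↦ by grind⟩
      rw [hcard, Nat.sub_add_cancel (by omega), add_comm]
      congr 1
      exact Nat.choose_symm_of_eq_add (by omega)
  · exact ⟨_, eq_of_card_eq_of_forall_mem hcard fun A hA ↦ by grind⟩

end Extremal

theorem stmt_8 (n : ℕ) (hn : 5 ≤ n) (F : Finset (Finset (Fin n)))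
    (hstar : ∀ A ∈ F, ∀ B ∈ F, ∀ C ∈ F, ∀ D ∈ F,
      A ≠ B → A ≠ C → A ≠ D → B ≠ C → B ≠ D → C ≠ D → ¬ (A ∪ B ⊆ C ∩ D))
    (hcard : F.card = n.choose (n / 2) + n.choose (n / 2 + 1)) :
    ∃ k, F = Finset.powersetCard k (Finset.univ : Finset (Fin n))
      ∪ Finset.powersetCard (k + 1) (Finset.univ : Finset (Fin n)) := by
  have h := ButterflyFree.eq_union_powersetCard (F := F) hstar (by simpa using hn)
    (by simpa using hcard)
  convert h
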